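/- For every ν ∈ [0,1), every ε ≥ 0 and every φ ∈ C_c^∞(ℝ³, ℂ²), one has ∫_{ℝ³} [ |((σ·∇)φ)(x)|² / (1 + ν/(|x|+ε)) + (1 − ν/(|x|+ε)) |φ(x)|² ] dx ≥ 0. -/

import Mathlib

open MeasureTheory Complex

noncomputable section

abbrev R3 := EuclideanSpace ℝ (Fin 3)
abbrev C2 := EuclideanSpace ℂ (Fin 2)

/-- The `k`-th partial derivative of `φ : ℝ³ → ℂ²`. -/
noncomputable def pd (φ : R3 → C2) (k : Fin 3) (x : R3) : C2 :=
  fderiv ℝ φ x (EuclideanSpace.single k 1)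

/-- `(σ·∇)φ = σ₁∂₁φ + σ₂∂₂φ + σ₃∂₃φ` with the Pauli matrices
`σ₁ = [[0,1],[1,0]]`, `σ₂ = [[0,-i],[i,0]]`, `σ₃ = [[1,0],[0,-1]]`. -/
noncomputable def sigmaGrad (φ : R3 → C2) (x : R3) : C2 :=
  (WithLp.equiv 2 (Fin 2 → ℂ)).symm
    ![pd φ 0 x 1 - Complex.I * pd φ 1 x 1 + pd φ 2 x 0,
      pd φ 0 x 0 + Complex.I * pd φ 1 x 0 - pd φ 2 x 1]

/-- `φ ∈ C_c^∞(ℝ³, ℂ²)`. -/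
def IsCc (φ : R3 → C2) : Prop := ContDiff ℝ (⊤ : ℕ∞) φ ∧ HasCompactSupport φ

theorem integral_eq_zero_of_hasLineDerivAt_of_ne_zero {F F' : R3 → ℝ} (l : Fin 3)
    (hF : Integrable F) (hF' : Integrable F')
    (h : ∀ x ≠ 0, HasLineDerivAt ℝ F (F' x) x (EuclideanSpace.single l 1)) :
    ∫ x, F' x = 0 := by
  have hψ : MeasurePreserving (((MeasurableEquiv.piFinSuccAbove (fun _ : Fin 3 => ℝ) l).symm.trans
      (MeasurableEquiv.toLp 2 (Fin 3 → ℝ)) : ℝ × (Fin 2 → ℝ) ≃ᵐ R3)) :=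
    (PiLp.volume_preserving_toLp (Fin 3)).comp
      ((volume_preserving_piFinSuccAbove (fun _ : Fin 3 => ℝ) l).symm _)
  set ψ := (MeasurableEquiv.piFinSuccAbove (fun _ : Fin 3 => ℝ) l).symm.trans
      (MeasurableEquiv.toLp 2 (Fin 3 → ℝ))
  have hψ_apply (z : ℝ × (Fin 2 → ℝ)) (i : Fin 3) :
      ψ z i = l.insertNth (α := fun _ => ℝ) z.1 z.2 i := rfl
  have hI := (hψ.integrable_comp_emb ψ.measurableEmbedding).2 hF
  have hI' := (hψ.integrable_comp_emb ψ.measurableEmbedding).2 hF'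
  rw [← hψ.integral_comp ψ.measurableEmbedding]
  change ∫ z, (F' ∘ ψ) z ∂(volume.prod volume) = 0
  rw [integral_prod_symm _ hI']
  refine integral_eq_zero_of_ae ?_
  have hne : ∀ᵐ y : Fin 2 → ℝ, y ≠ 0 := by simp [ae_iff, measure_singleton]
  filter_upwards [hne, hI.prod_left_ae, hI'.prod_left_ae] with y hy h1 h2
  refine integral_eq_zero_of_hasDerivAt_of_integrable (fun t => ?_) h2 h1
  have hψ0 : ψ (t, y) ≠ 0 := fun h0 => hy <| funext fun i => by
    simpa [hψ_apply] using congrArg (fun v : R3 => v (l.succAbove i)) h0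
  have := h _ hψ0
  have e (s : ℝ) : ψ (s, y) = ψ (t, y) + (s - t) • EuclideanSpace.single l (1 : ℝ) := by
    ext i
    rcases Fin.eq_self_or_eq_succAbove l i with rfl | ⟨j, rfl⟩ <;> simp [hψ_apply]
  have h3 := HasDerivAt.comp_sub_const t t (by simpa [HasLineDerivAt] using this :
    HasDerivAt (fun s : ℝ => F (ψ (t, y) + s • EuclideanSpace.single l (1 : ℝ))) _ (t - t))
  exact h3.congr_of_eventuallyEq (.of_forall fun s => by simp [e s])

/-- The form `om k u v = Re ⟨u, i σ_k v⟩` in real coordinates. -/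
def om (k : Fin 3) (u v : Fin 4 → ℝ) : ℝ :=
  ![-(u 0 * v 3) + u 1 * v 2 - u 2 * v 1 + u 3 * v 0,
    u 0 * v 2 + u 1 * v 3 - u 2 * v 0 - u 3 * v 1,
    -(u 0 * v 1) + u 1 * v 0 + u 2 * v 3 - u 3 * v 2] k

/-- Multiplication by `i σ·x` in real coordinates. -/
def iSig (x : Fin 3 → ℝ) (v : Fin 4 → ℝ) : Fin 4 → ℝ :=
  ![x 0 * -v 3 + x 1 * v 2 + x 2 * - v 1, x 0 * v 2 + x 1 * v 3 + x 2 * v 0,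
    x 0 * -v 1 + x 1 * -v 0 + x 2 * v 3, x 0 * v 0 + x 1 * -v 1 + x 2 * -v 2]

theorem sq_mul_sub_eq_sum_sq (x : Fin 3 → ℝ) (d : Fin 3 → Fin 4 → ℝ) :
    2 * (∑ l, x l ^ 2) ^ 2 *
        ((∑ l, ∑ j, (x (l + 1) * d (l + 2) j - x (l + 2) * d (l + 1) j) ^ 2) -
          2 * ∑ l, ∑ k, x l * x k * om k (d (l + 1)) (d (l + 2))) =
      ∑ l, ∑ j, ((∑ l, x l ^ 2) * (x (l + 1) * d (l + 2) j - x (l + 2) * d (l + 1) j) -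
        iSig x (fun j => (∑ l, x l ^ 2) * d l j - x l * ∑ k, x k * d k j) j) ^ 2 := by
  have h1 : (1 : Fin 3) + 1 = 2 := rfl
  have h2 : (1 : Fin 3) + 2 = 0 := rfl
  have h3 : (2 : Fin 3) + 2 = 1 := rfl
  have h4 : (2 : Fin 3) + 1 = 0 := rfl
  simp [Fin.sum_univ_three, Fin.sum_univ_four, om, iSig, h1, h2, h3, h4]
  ring

theorem integrable_mul_of_abs_le_inv_norm {m s : R3 → ℝ} (hm : ContinuousOn m {0}ᶜ)
    (hC : ∀ x ≠ 0, |m x| ≤ ‖x‖⁻¹) (hs : Continuous s) (hsc : HasCompactSupport s) :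
    Integrable fun x => m x * s x := by
  have hmm : AEStronglyMeasurable m := by
    have := hm.aestronglyMeasurable (μ := volume) (measurableSet_singleton (0 : R3)).compl
    rwa [restrict_compl_singleton] at this
  have hne : ∀ᵐ x : R3, x ≠ 0 := by simp [ae_iff, measure_singleton]
  have hl : LocallyIntegrable m := by
    refine locallyIntegrable_of_norm_le_rpow (C := 1) (α := 1) (by simp) (by simp) ?_ hmm
    filter_upwards [hne] with x hx
    simpa [Real.rpow_neg_one] using hC x hx
  simpa using hl.integrable_smul_right_of_hasCompactSupport hs hsc

/-- The partial derivative of `f` in the direction of the `l`-th basis vector. -/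
def partialDeriv (l : Fin 3) (f : R3 → ℝ) (x : R3) : ℝ :=
  fderiv ℝ f x (EuclideanSpace.single l 1)

section partialDeriv

variable {f : R3 → ℝ}

theorem contDiff_partialDeriv (hf : ContDiff ℝ (⊤ : ℕ∞) f) (l : Fin 3) :
    ContDiff ℝ (⊤ : ℕ∞) (partialDeriv l f) :=
  (hf.fderiv_right (m := (⊤ : ℕ∞)) (by simp)).clm_apply contDiff_const

theorem hasCompactSupport_partialDeriv (hf : HasCompactSupport f) (l : Fin 3) :
    HasCompactSupport (partialDeriv l f) :=
  hf.fderiv_apply ℝ _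

theorem hasLineDerivAt_partialDeriv (hf : ContDiff ℝ (⊤ : ℕ∞) f) (l : Fin 3) (x : R3) :
    HasLineDerivAt ℝ f (partialDeriv l f x) x (EuclideanSpace.single l 1) :=
  (hf.differentiable (by simp) x).hasFDerivAt.hasLineDerivAt _

theorem partialDeriv_eq_of_hasLineDerivAt (hf : ContDiff ℝ (⊤ : ℕ∞) f) {l : Fin 3} {x : R3} {c : ℝ}
    (h : HasLineDerivAt ℝ f c x (EuclideanSpace.single l 1)) : partialDeriv l f x = c :=
  (hasLineDerivAt_partialDeriv hf l x).unique h

theorem partialDeriv_comm (hf : ContDiff ℝ (⊤ : ℕ∞) f) (k l : Fin 3) (x : R3) :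
    partialDeriv k (partialDeriv l f) x = partialDeriv l (partialDeriv k f) x := by
  have hd : DifferentiableAt ℝ (fderiv ℝ f) x :=
    (hf.fderiv_right (m := (⊤ : ℕ∞)) (by simp)).differentiable (by simp) x
  have hs : IsSymmSndFDerivAt ℝ f x :=
    (contDiff_infty.1 hf 2).contDiffAt.isSymmSndFDerivAt (by simp)
  have e (k l : Fin 3) : partialDeriv k (partialDeriv l f) x =
      fderiv ℝ (fderiv ℝ f) x (EuclideanSpace.single k 1) (EuclideanSpace.single l 1) := by
    change fderiv ℝ (fun y => fderiv ℝ f y (EuclideanSpace.single l 1)) x _ = _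
    rw [fderiv_clm_apply hd (by fun_prop)]
    simp
  rw [e, e, hs.eq]

end partialDeriv

theorem hasLineDerivAt_coord (x : R3) (k l : Fin 3) :
    HasLineDerivAt ℝ (fun y : R3 => y k) (if k = l then 1 else 0) x (EuclideanSpace.single l 1) := by
  have := ((EuclideanSpace.proj (𝕜 := ℝ) k : R3 →L[ℝ] ℝ).hasFDerivAt (x := x)).hasLineDerivAt
    (EuclideanSpace.single l (1 : ℝ))
  simpa [Pi.single_apply] using this

theorem hasLineDerivAt_norm {x : R3} (hx : x ≠ 0) (l : Fin 3) :
    HasLineDerivAt ℝ (fun y : R3 => ‖y‖) (x l / ‖x‖) x (EuclideanSpace.single l 1) := by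
  have h1 : HasDerivAt (fun t : ℝ => ‖x + t • EuclideanSpace.single l (1 : ℝ)‖ ^ 2) (2 * x l) 0 := by
    have hd : HasDerivAt (fun t : ℝ => x + t • EuclideanSpace.single l (1 : ℝ))
        (EuclideanSpace.single l (1 : ℝ)) 0 := by
      simpa using ((hasDerivAt_id (0 : ℝ)).smul_const (EuclideanSpace.single l (1 : ℝ))).const_add x
    simpa [EuclideanSpace.inner_single_right] using hd.norm_sq
  have h2 := h1.sqrt (by simpa using hx)
  simp only [Real.sqrt_sq (norm_nonneg _), zero_smul, add_zero] at h2
  exact HasDerivAt.congr_deriv h2 (by ring)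

/-- Smoothness and compact support of a real function. -/
def IsTest (f : R3 → ℝ) : Prop := ContDiff ℝ (⊤ : ℕ∞) f ∧ HasCompactSupport f

/-- The field `(w g - (x_l / |x|) n)`, with `w = |x| / (1 + |x|)`, has integrable partial derivative
of vanishing integral. -/
theorem integrable_and_integral_eq_zero {g n : R3 → ℝ} (hg : IsTest g) (hn : IsTest n)
    (l : Fin 3) :
    let F' : R3 → ℝ := fun x =>
      (x l / (‖x‖ * (1 + ‖x‖) ^ 2)) * g x + (‖x‖ / (1 + ‖x‖)) * partialDeriv l g x
        - ((‖x‖⁻¹ - x l ^ 2 / ‖x‖ ^ 3) * n x + ‖x‖⁻¹ * (x l * partialDeriv l n x))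
    Integrable F' ∧ ∫ x, F' x = 0 := by
  intro F'
  have hc : Continuous fun x : R3 => x l := by fun_prop
  have hw : Continuous fun x : R3 => ‖x‖ / (1 + ‖x‖) :=
    continuous_norm.div (by fun_prop) fun x => by positivity
  have hinv : ContinuousOn (fun x : R3 => ‖x‖⁻¹) {0}ᶜ :=
    continuous_norm.continuousOn.inv₀ fun x hx => by simpa using hx
  have hxl (x : R3) : |x l| ≤ ‖x‖ := by simpa using PiLp.norm_apply_le x l
  have hg' := contDiff_partialDeriv hg.1 l
  have hn' := contDiff_partialDeriv hn.1 l
  have i1 : Integrable fun x : R3 => (x l / (‖x‖ * (1 + ‖x‖) ^ 2)) * g x := by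
    refine integrable_mul_of_abs_le_inv_norm ?_ (fun x hx => ?_) hg.1.continuous hg.2
    · refine hc.continuousOn.div (by fun_prop) fun x hx => ?_
      have : ‖x‖ ≠ 0 := by simpa using hx
      positivity
    · have h0 : 0 < ‖x‖ := norm_pos_iff.2 hx
      rw [abs_div, abs_of_pos (by positivity : 0 < ‖x‖ * (1 + ‖x‖) ^ 2), inv_eq_one_div,
        div_le_div_iff₀ (by positivity) h0]
      nlinarith [hxl x, mul_le_mul_of_nonneg_right (hxl x) h0.le, pow_pos h0 2, pow_pos h0 3]
  have i2 : Integrable fun x : R3 => (‖x‖ / (1 + ‖x‖)) * partialDeriv l g x :=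
    (hw.mul hg'.continuous).integrable_of_hasCompactSupport
      (hasCompactSupport_partialDeriv hg.2 l).mul_left
  have i3 : Integrable fun x : R3 => (‖x‖⁻¹ - x l ^ 2 / ‖x‖ ^ 3) * n x := by
    refine integrable_mul_of_abs_le_inv_norm ?_ (fun x hx => ?_) hn.1.continuous hn.2
    · refine hinv.sub ((hc.pow 2).continuousOn.div (by fun_prop) fun x hx => ?_)
      have : ‖x‖ ≠ 0 := by simpa using hx
      positivity
    · have h0 : 0 < ‖x‖ := norm_pos_iff.2 hx
      have h1 : x l ^ 2 / ‖x‖ ^ 3 ≤ ‖x‖⁻¹ := by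
        rw [inv_eq_one_div, div_le_div_iff₀ (by positivity) h0]
        nlinarith [mul_le_mul_of_nonneg_right (sq_le_sq' (neg_le_of_abs_le (hxl x))
          (le_of_abs_le (hxl x))) h0.le]
      have h2 : 0 ≤ x l ^ 2 / ‖x‖ ^ 3 := by positivity
      rw [abs_le]; constructor <;> linarith [inv_pos.2 h0]
  have hinvle : ∀ x : R3, x ≠ 0 → |‖x‖⁻¹| ≤ ‖x‖⁻¹ := fun x _ => by simp
  have i4 : Integrable fun x : R3 => ‖x‖⁻¹ * (x l * partialDeriv l n x) :=
    integrable_mul_of_abs_le_inv_norm hinv hinvle (hc.mul hn'.continuous)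
      (hasCompactSupport_partialDeriv hn.2 l).mul_left
  have hI' : Integrable F' := (i1.add i2).sub (i3.add i4)
  have j1 : Integrable fun x : R3 => (‖x‖ / (1 + ‖x‖)) * g x :=
    (hw.mul hg.1.continuous).integrable_of_hasCompactSupport hg.2.mul_left
  have j2 : Integrable fun x : R3 => ‖x‖⁻¹ * (x l * n x) :=
    integrable_mul_of_abs_le_inv_norm hinv hinvle (hc.mul hn.1.continuous) hn.2.mul_left
  refine ⟨hI', integral_eq_zero_of_hasLineDerivAt_of_ne_zero l (j1.sub j2) hI' fun x hx => ?_⟩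
  have h0 : 0 < ‖x‖ := norm_pos_iff.2 hx
  have dr : HasDerivAt _ _ _ := hasLineDerivAt_norm hx l
  have dc : HasDerivAt _ _ _ := hasLineDerivAt_coord x l l
  have dg : HasDerivAt _ _ _ := hasLineDerivAt_partialDeriv hg.1 l x
  have dn : HasDerivAt _ _ _ := hasLineDerivAt_partialDeriv hn.1 l x
  have := (((dr.fun_div (dr.const_add 1) (by simp; positivity)).fun_mul dg).fun_sub
    ((dr.fun_inv (by simpa using hx)).fun_mul (dc.fun_mul dn)))
  refine HasDerivAt.congr_deriv this ?_
  simp [F']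
  field_simp
  ring

/-- The field `x ↦ ∑ k, x_k om k (∂_{l+1} f) (∂_{l+2} f)`, cyclic indices. -/
def omField (f : Fin 4 → R3 → ℝ) (l : Fin 3) (x : R3) : ℝ :=
  ∑ k, x k * om k (fun j => partialDeriv (l + 1) (f j) x) (fun j => partialDeriv (l + 2) (f j) x)

theorem contDiff_om {u v : Fin 4 → R3 → ℝ} (hu : ∀ j, ContDiff ℝ (⊤ : ℕ∞) (u j))
    (hv : ∀ j, ContDiff ℝ (⊤ : ℕ∞) (v j)) (k : Fin 3) :
    ContDiff ℝ (⊤ : ℕ∞) fun x => om k (fun j => u j x) (fun j => v j x) := by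
  fin_cases k <;> simp [om] <;> fun_prop

theorem hasDerivAt_om {u v : ℝ → Fin 4 → ℝ} {u' v' : Fin 4 → ℝ} {t : ℝ}
    (hu : ∀ j, HasDerivAt (fun s => u s j) (u' j) t)
    (hv : ∀ j, HasDerivAt (fun s => v s j) (v' j) t) (k : Fin 3) :
    HasDerivAt (fun s => om k (u s) (v s)) (om k u' (v t) + om k (u t) v') t := by
  have h (i j : Fin 4) := (hu i).fun_mul (hv j)
  fin_cases k
  · exact ((((h 0 3).fun_neg.fun_add (h 1 2)).fun_sub (h 2 1)).fun_add (h 3 0)).congr_deriv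
      (by simp [om]; ring)
  · exact ((((h 0 2).fun_add (h 1 3)).fun_sub (h 2 0)).fun_sub (h 3 1)).congr_deriv
      (by simp [om]; ring)
  · exact ((((h 0 1).fun_neg.fun_add (h 1 0)).fun_add (h 2 3)).fun_sub (h 3 2)).congr_deriv
      (by simp [om]; ring)

theorem isTest_omField {f : Fin 4 → R3 → ℝ} (hf : ∀ j, IsTest (f j)) (l : Fin 3) :
    IsTest (omField f l) := by
  have hc (l j) := contDiff_partialDeriv (hf j).1 l
  refine ⟨ContDiff.sum fun k _ => ContDiff.mul (by fun_prop) (contDiff_om (hc _) (hc _) k), ?_⟩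
  have hs (j) := hasCompactSupport_partialDeriv (hf j).2 (l + 1)
  refine HasCompactSupport.intro (isCompact_iUnion fun j => hs j) fun x hx => ?_
  simp only [Set.mem_iUnion, not_exists] at hx
  have h0 (j) : partialDeriv (l + 1) (f j) x = 0 := image_eq_zero_of_notMem_tsupport (hx j)
  refine Finset.sum_eq_zero fun k _ => ?_
  fin_cases k <;> simp [om, h0]

theorem partialDeriv_omField {f : Fin 4 → R3 → ℝ} (hf : ∀ j, IsTest (f j)) (l : Fin 3) (x : R3) :
    partialDeriv l (omField f l) x =
      om l (fun j => partialDeriv (l + 1) (f j) x) (fun j => partialDeriv (l + 2) (f j) x) +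
      ∑ k, x k * (om k (fun j => partialDeriv l (partialDeriv (l + 1) (f j)) x)
          (fun j => partialDeriv (l + 2) (f j) x) +
        om k (fun j => partialDeriv (l + 1) (f j) x)
          (fun j => partialDeriv l (partialDeriv (l + 2) (f j)) x)) := by
  refine partialDeriv_eq_of_hasLineDerivAt (isTest_omField hf l).1 ?_
  have hd (i j) : HasDerivAt _ _ _ :=
    hasLineDerivAt_partialDeriv (contDiff_partialDeriv (hf j).1 i) l x
  have hk (k) : HasDerivAt _ _ _ := hasLineDerivAt_coord x k l
  refine (HasDerivAt.fun_sum (u := Finset.univ) fun k _ =>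
    (hk k).fun_mul (hasDerivAt_om (hd (l + 1)) (hd (l + 2)) k)).congr_deriv ?_
  simp [Finset.sum_add_distrib]

theorem sum_partialDeriv_omField {f : Fin 4 → R3 → ℝ} (hf : ∀ j, IsTest (f j)) (x : R3) :
    ∑ l, partialDeriv l (omField f l) x = ∑ l,
      om l (fun j => partialDeriv (l + 1) (f j) x) (fun j => partialDeriv (l + 2) (f j) x) := by
  simp_rw [partialDeriv_omField hf]
  rw [Finset.sum_add_distrib, add_eq_left]
  have h1 : (1 : Fin 3) + 1 = 2 := rfl
  have h2 : (1 : Fin 3) + 2 = 0 := rfl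
  have h3 : (2 : Fin 3) + 2 = 1 := rfl
  have h4 : (2 : Fin 3) + 1 = 0 := rfl
  simp only [Fin.sum_univ_three, zero_add, h1, h2, h3, h4,
    fun j => partialDeriv_comm (hf j).1 1 0 x, fun j => partialDeriv_comm (hf j).1 2 0 x,
    fun j => partialDeriv_comm (hf j).1 2 1 x]
  simp [om]
  ring

/-- Sum of squares of the real coordinates. -/
def nsq (f : Fin 4 → R3 → ℝ) (x : R3) : ℝ := ∑ j, f j x ^ 2

theorem isTest_nsq {f : Fin 4 → R3 → ℝ} (hf : ∀ j, IsTest (f j)) : IsTest (nsq f) := by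
  refine ⟨ContDiff.sum fun j _ => (hf j).1.pow 2, ?_⟩
  refine HasCompactSupport.intro (isCompact_iUnion fun j => (hf j).2) fun x hx => ?_
  simp only [Set.mem_iUnion, not_exists] at hx
  have h0 (j) : f j x = 0 := image_eq_zero_of_notMem_tsupport (hx j)
  simp [nsq, h0]

theorem partialDeriv_nsq {f : Fin 4 → R3 → ℝ} (hf : ∀ j, IsTest (f j)) (l : Fin 3) (x : R3) :
    partialDeriv l (nsq f) x = 2 * ∑ j, f j x * partialDeriv l (f j) x := by
  refine partialDeriv_eq_of_hasLineDerivAt (isTest_nsq hf).1 ?_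
  have hd (j) : HasDerivAt _ _ _ := hasLineDerivAt_partialDeriv (hf j).1 l x
  refine (HasDerivAt.fun_sum (u := Finset.univ) fun j _ => (hd j).fun_pow 2).congr_deriv ?_
  simp [Finset.mul_sum, mul_assoc]

theorem two_mul_sum_om_le (x : Fin 3 → ℝ) (d : Fin 3 → Fin 4 → ℝ) :
    2 * ∑ l, ∑ k, x l * x k * om k (d (l + 1)) (d (l + 2)) ≤
      ∑ l, ∑ j, (x (l + 1) * d (l + 2) j - x (l + 2) * d (l + 1) j) ^ 2 := by
  by_cases hx : x = 0
  · simp [hx]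
  have hpos : 0 < ∑ l, x l ^ 2 := by
    obtain ⟨i, hi⟩ := Function.ne_iff.1 hx
    have : 0 < x i ^ 2 := by simp at hi; positivity
    exact this.trans_le (Finset.single_le_sum (fun l _ => sq_nonneg (x l)) (Finset.mem_univ i))
  have h := sq_mul_sub_eq_sum_sq x d
  have h' := Finset.sum_nonneg fun l (_ : l ∈ Finset.univ) =>
    Finset.sum_nonneg fun j (_ : j ∈ Finset.univ) => sq_nonneg
      ((∑ l, x l ^ 2) * (x (l + 1) * d (l + 2) j - x (l + 2) * d (l + 1) j) -
        iSig x (fun j => (∑ l, x l ^ 2) * d l j - x l * ∑ k, x k * d k j) j)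
  rw [← h] at h'
  exact sub_nonneg.1 (nonneg_of_mul_nonneg_right h' (by positivity))

/-- The pointwise inequality behind the Hardy-Dirac inequality: the integrand for the potential
`1 / r` dominates a divergence. -/
theorem divergence_le_hardy_integrand (x : Fin 3 → ℝ) (p : Fin 4 → ℝ) (d : Fin 3 → Fin 4 → ℝ)
    (r : ℝ) (hr : 0 < r)
    (hx : ∑ l, x l ^ 2 = r ^ 2) :
    2 * ((∑ l, ∑ k, x l * x k * om k (d (l + 1)) (d (l + 2))) / (r * (1 + r) ^ 2) +
        r / (1 + r) * ∑ l, om l (d (l + 1)) (d (l + 2))) -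
      (2 / r * ∑ j, p j ^ 2 + 2 / r * ∑ j, p j * ∑ l, x l * d l j) ≤
    r / (1 + r) * (∑ l, ∑ j, d l j ^ 2 + 2 * ∑ l, om l (d (l + 1)) (d (l + 2))) +
      (1 - 1 / r) * ∑ j, p j ^ 2 := by
  have hE := two_mul_sum_om_le x d
  set E := ∑ l, ∑ k, x l * x k * om k (d (l + 1)) (d (l + 2))
  set R := ∑ l, ∑ j, (x (l + 1) * d (l + 2) j - x (l + 2) * d (l + 1) j) ^ 2 with hR
  set O := ∑ l, om l (d (l + 1)) (d (l + 2))
  have hR0 : 0 ≤ R := by positivity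
  have hlag : r ^ 2 * ∑ l, ∑ j, d l j ^ 2 = ∑ j, (∑ l, x l * d l j) ^ 2 + R := by
    have h1 : (1 : Fin 3) + 1 = 2 := rfl
    have h2 : (1 : Fin 3) + 2 = 0 := rfl
    have h3 : (2 : Fin 3) + 2 = 1 := rfl
    have h4 : (2 : Fin 3) + 1 = 0 := rfl
    rw [← hx, hR]
    simp only [Fin.sum_univ_three, Fin.sum_univ_four, zero_add, h1, h2, h3, h4]
    ring
  have hsq : 0 ≤ ∑ j, (∑ l, x l * d l j + (1 + r) * p j) ^ 2 := by positivity
  have hexp : ∑ j, (∑ l, x l * d l j + (1 + r) * p j) ^ 2 = ∑ j, (∑ l, x l * d l j) ^ 2 +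
      2 * (1 + r) * ∑ j, p j * ∑ l, x l * d l j + (1 + r) ^ 2 * ∑ j, p j ^ 2 := by
    simp only [Finset.mul_sum, ← Finset.sum_add_distrib]
    refine Finset.sum_congr rfl fun j _ => ?_
    simp only [← Finset.mul_sum]
    ring
  have hG : ∑ l, ∑ j, d l j ^ 2 = (∑ j, (∑ l, x l * d l j) ^ 2 + R) / r ^ 2 := by
    rw [← hlag]; field_simp
  rw [hG]
  rw [hexp] at hsq
  set X := ∑ j, (∑ l, x l * d l j) ^ 2
  set Y := ∑ j, p j * ∑ l, x l * d l j
  set N := ∑ j, p j ^ 2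
  rw [← sub_nonneg]
  have : r / (1 + r) * ((X + R) / r ^ 2 + 2 * O) + (1 - 1 / r) * N -
      (2 * (E / (r * (1 + r) ^ 2) + r / (1 + r) * O) - (2 / r * N + 2 / r * Y)) =
      (X + 2 * (1 + r) * Y + (1 + r) ^ 2 * N) / (r * (1 + r)) +
        ((R - 2 * E) + r * R) / (r * (1 + r) ^ 2) := by
    field_simp
    ring
  rw [this]
  have : 0 ≤ (R - 2 * E) + r * R := by nlinarith
  positivity

/-- The real coordinates of a spinor field. -/
def realCoord (φ : R3 → C2) (j : Fin 4) (x : R3) : ℝ :=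
  ![(φ x 0).re, (φ x 0).im, (φ x 1).re, (φ x 1).im] j

theorem exists_realCoord_eq (j : Fin 4) :
    ∃ L : C2 →L[ℝ] ℝ, ∀ v, L v = ![(v 0).re, (v 0).im, (v 1).re, (v 1).im] j := by
  let P (i : Fin 2) : C2 →L[ℝ] ℂ := (EuclideanSpace.proj (𝕜 := ℂ) i).restrictScalars ℝ
  fin_cases j
  · exact ⟨reCLM.comp (P 0), fun v => rfl⟩
  · exact ⟨imCLM.comp (P 0), fun v => rfl⟩
  · exact ⟨reCLM.comp (P 1), fun v => rfl⟩
  · exact ⟨imCLM.comp (P 1), fun v => rfl⟩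

theorem isTest_realCoord {φ : R3 → C2} (hφ : IsCc φ) (j : Fin 4) : IsTest (realCoord φ j) := by
  obtain ⟨L, hL⟩ := exists_realCoord_eq j
  have : realCoord φ j = L ∘ φ := funext fun x => (hL _).symm
  rw [this]
  exact ⟨L.contDiff.comp hφ.1, hφ.2.comp_left L.map_zero⟩

theorem partialDeriv_realCoord {φ : R3 → C2} (hφ : IsCc φ) (l : Fin 3) (j : Fin 4) (x : R3) :
    partialDeriv l (realCoord φ j) x =
      ![(pd φ l x 0).re, (pd φ l x 0).im, (pd φ l x 1).re, (pd φ l x 1).im] j := by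
  obtain ⟨L, hL⟩ := exists_realCoord_eq j
  have : realCoord φ j = L ∘ φ := funext fun x => (hL _).symm
  rw [this, ← hL, partialDeriv,
    (L.hasFDerivAt.comp x (hφ.1.differentiable (by simp) x).hasFDerivAt).fderiv]
  rfl

theorem norm_sq_eq_nsq (φ : R3 → C2) (x : R3) : ‖φ x‖ ^ 2 = nsq (realCoord φ) x := by
  simp [EuclideanSpace.norm_sq_eq, nsq, realCoord, Fin.sum_univ_four, Complex.sq_norm,
    Complex.normSq_apply]
  ring

theorem norm_sq_sigmaGrad {φ : R3 → C2} (hφ : IsCc φ) (x : R3) :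
    ‖sigmaGrad φ x‖ ^ 2 = ∑ l, ∑ j, partialDeriv l (realCoord φ j) x ^ 2 +
      2 * ∑ l, om l (fun j => partialDeriv (l + 1) (realCoord φ j) x)
        (fun j => partialDeriv (l + 2) (realCoord φ j) x) := by
  have h1 : (1 : Fin 3) + 1 = 2 := rfl
  have h2 : (1 : Fin 3) + 2 = 0 := rfl
  have h3 : (2 : Fin 3) + 2 = 1 := rfl
  have h4 : (2 : Fin 3) + 1 = 0 := rfl
  simp [partialDeriv_realCoord hφ, EuclideanSpace.norm_sq_eq, sigmaGrad, Fin.sum_univ_three,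
    Fin.sum_univ_four, Complex.sq_norm, Complex.normSq_apply, h1, h2, h3, h4, om]
  ring

/-- Nonnegativity of the quadratic form `Q^T_{0,ν,ε}` for regularized Coulomb
potentials `-ν/(|x|+ε)`, `0 ≤ ν < 1`, `ε ≥ 0`. -/
theorem Q_nonneg_regularized_coulomb (ν : ℝ) (hν : ν ∈ Set.Ico (0 : ℝ) 1)
    (ε : ℝ) (hε : 0 ≤ ε) (φ : R3 → C2) (hφ : IsCc φ) :
    0 ≤ ∫ x : R3,
        (‖sigmaGrad φ x‖ ^ 2 / (1 + ν / (‖x‖ + ε)) +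
          (1 - ν / (‖x‖ + ε)) * ‖φ x‖ ^ 2) := by
  have hf := isTest_realCoord hφ
  set f := realCoord φ
  by_cases hI : Integrable fun x : R3 => (‖sigmaGrad φ x‖ ^ 2 / (1 + ν / (‖x‖ + ε)) +
          (1 - ν / (‖x‖ + ε)) * ‖φ x‖ ^ 2)
  swap
  · rw [integral_undef hI]
  have hg (l) : IsTest fun x => 2 * omField f l x :=
    ⟨contDiff_const.mul (isTest_omField hf l).1, (isTest_omField hf l).2.mul_left⟩
  have hg' (l x) : partialDeriv l (fun x => 2 * omField f l x) x =
      2 * partialDeriv l (omField f l) x := by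
    refine partialDeriv_eq_of_hasLineDerivAt (hg l).1 ?_
    have : HasDerivAt _ _ _ := hasLineDerivAt_partialDeriv (isTest_omField hf l).1 l x
    exact this.const_mul 2
  have hF (l) := integrable_and_integral_eq_zero (hg l) (isTest_nsq hf) l
  simp only at hF
  have h0 := integral_finsetSum Finset.univ fun l _ => (hF l).1
  rw [Finset.sum_eq_zero fun l _ => (hF l).2] at h0
  rw [← h0]
  refine integral_mono_ae (integrable_finsetSum _ fun l _ => (hF l).1) hI ?_
  have hne : ∀ᵐ x : R3, x ≠ 0 := by simp [ae_iff, measure_singleton]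
  filter_upwards [hne] with x hx
  have hr : 0 < ‖x‖ := norm_pos_iff.2 hx
  have hxr : ∑ l, x l ^ 2 = ‖x‖ ^ 2 := by simp [EuclideanSpace.norm_sq_eq]
  have hV0 : 0 ≤ ν / (‖x‖ + ε) := div_nonneg hν.1 (by positivity)
  have hV1 : ν / (‖x‖ + ε) ≤ 1 / ‖x‖ := div_le_div₀ zero_le_one hν.2.le hr (by linarith)
  have hw : ‖x‖ / (1 + ‖x‖) = 1 / (1 + 1 / ‖x‖) := by field_simp; ring
  have hmono : ‖x‖ / (1 + ‖x‖) * ‖sigmaGrad φ x‖ ^ 2 + (1 - 1 / ‖x‖) * ‖φ x‖ ^ 2 ≤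
      ‖sigmaGrad φ x‖ ^ 2 / (1 + ν / (‖x‖ + ε)) + (1 - ν / (‖x‖ + ε)) * ‖φ x‖ ^ 2 := by
    rw [hw, div_eq_inv_mul (‖sigmaGrad φ x‖ ^ 2), ← one_div]
    gcongr
  refine le_trans (le_of_eq ?_) ((divergence_le_hardy_integrand x (fun j => f j x)
    (fun l j => partialDeriv l (f j) x) ‖x‖ hr hxr).trans (le_trans (le_of_eq ?_) hmono))
  · rw [← sum_partialDeriv_omField hf]
    simp only [hg', partialDeriv_nsq hf]
    have e1 : ∑ l, ∑ k, x l * x k * om k (fun j => partialDeriv (l + 1) (f j) x)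
        (fun j => partialDeriv (l + 2) (f j) x) = ∑ l, x l * omField f l x := by
      simp [omField, Finset.mul_sum, mul_assoc]
    have e2 : ∑ j, f j x * ∑ l, x l * partialDeriv l (f j) x =
        ∑ l, x l * ∑ j, f j x * partialDeriv l (f j) x := by
      simp only [Finset.mul_sum]
      rw [Finset.sum_comm]
      exact Finset.sum_congr rfl fun _ _ => Finset.sum_congr rfl fun _ _ => by ring
    rw [e1, e2]
    change _ = _ - (2 / ‖x‖ * nsq f x + _)
    have e3 : 2 / ‖x‖ = ∑ l, (‖x‖⁻¹ - x l ^ 2 / ‖x‖ ^ 3) := by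
      rw [Finset.sum_sub_distrib, ← Finset.sum_div, hxr]
      simp
      field_simp
      norm_num
    rw [show 2 / ‖x‖ * nsq f x = (∑ l, (‖x‖⁻¹ - x l ^ 2 / ‖x‖ ^ 3)) * nsq f x by rw [e3]]
    simp only [Fin.sum_univ_three]
    ring
  · rw [norm_sq_sigmaGrad hφ, norm_sq_eq_nsq]
    rfl
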